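/- Let m ∈ ℕ⁺ and V ∈ C^∞(𝕋², ℝ). There exists a smooth real-valued function β ∈ C^∞(𝕋², ℝ) such that V(t,x) + m ∂_x β(t,x) − ∂_t β(t,x) = ⟨V⟩_m(x + mt) for all (t,x) ∈ 𝕋². -/

import Mathlib

open Real

universe u

/-- Differentiation under the integral sign, for a `C¹` integrand on a compact interval. -/
theorem hasFDerivAt_intervalIntegral_of_contDiff {H E : Type*}
    [NormedAddCommGroup H] [NormedSpace ℝ H] [ProperSpace H]
    [NormedAddCommGroup E] [NormedSpace ℝ E]
    {F : H × ℝ → E} (hF : ContDiff ℝ 1 F) (a b : ℝ) (x₀ : H) :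
    HasFDerivAt (fun x => ∫ s in a..b, F (x, s))
      (∫ s in a..b, (fderiv ℝ F (x₀, s)).comp (ContinuousLinearMap.inl ℝ H ℝ)) x₀ := by
  have hF' : Continuous fun p => (fderiv ℝ F p).comp (ContinuousLinearMap.inl ℝ H ℝ) :=
    (hF.continuous_fderiv one_ne_zero).clm_comp continuous_const
  obtain ⟨C, hC⟩ := ((isCompact_closedBall x₀ 1).prod
    (isCompact_uIcc (a := a) (b := b))).exists_bound_of_continuousOn hF'.continuousOn
  refine (intervalIntegral.hasFDerivAt_integral_of_dominated_of_fderiv_le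
    (F' := fun x s => (fderiv ℝ F (x, s)).comp (ContinuousLinearMap.inl ℝ H ℝ))
    (bound := fun _ => C) (Metric.closedBall_mem_nhds x₀ one_pos) ?_ ?_ ?_ ?_ ?_ ?_)
  · exact .of_forall fun x => Continuous.aestronglyMeasurable (by fun_prop)
  · exact Continuous.intervalIntegrable (by fun_prop) _ _
  · exact (hF'.comp (by fun_prop : Continuous fun s : ℝ => (x₀, s))).aestronglyMeasurable
  · exact .of_forall fun s hs x hx => hC (x, s) ⟨hx, Set.uIoc_subset_uIcc hs⟩
  · exact intervalIntegrable_const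
  · refine .of_forall fun s _ x _ => ?_
    exact (hF.differentiable one_ne_zero (x, s)).hasFDerivAt.comp x (hasFDerivAt_prodMk_left x s)

theorem contDiff_nat_intervalIntegral {H : Type u} [NormedAddCommGroup H] [NormedSpace ℝ H]
    [ProperSpace H] (a b : ℝ) (n : ℕ) :
    ∀ {E : Type u} [NormedAddCommGroup E] [NormedSpace ℝ E] {F : H × ℝ → E},
      ContDiff ℝ (n + 1 : ℕ) F → ContDiff ℝ n fun x => ∫ s in a..b, F (x, s) := by
  induction n with
  | zero =>
    intro E _ _ F hF
    refine contDiff_zero.2 (continuous_iff_continuousAt.2 fun x => ?_)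
    exact (hasFDerivAt_intervalIntegral_of_contDiff (by simpa using hF) a b x).continuousAt
  | succ n ih =>
    intro E _ _ F hF
    have h1 : ContDiff ℝ 1 F := hF.of_le (by exact_mod_cast Nat.le_add_left 1 (n + 1))
    push_cast
    refine contDiff_succ_iff_hasFDerivAt.2
      ⟨_, ih (F := fun p => (fderiv ℝ F p).comp (ContinuousLinearMap.inl ℝ H ℝ)) ?_,
        hasFDerivAt_intervalIntegral_of_contDiff h1 a b⟩
    exact (hF.fderiv_right (by norm_cast)).clm_comp contDiff_const

theorem contDiff_infty_intervalIntegral {H E : Type u}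
    [NormedAddCommGroup H] [NormedSpace ℝ H] [ProperSpace H]
    [NormedAddCommGroup E] [NormedSpace ℝ E]
    {F : H × ℝ → E} (hF : ContDiff ℝ (⊤ : ℕ∞) F) (a b : ℝ) :
    ContDiff ℝ (⊤ : ℕ∞) fun x => ∫ s in a..b, F (x, s) :=
  contDiff_infty.2 fun n => contDiff_nat_intervalIntegral a b n (contDiff_infty.1 hF (n + 1))

/-- The moment `∫₀ᵀ s g(u + s) ds` of a `T`-periodic function `g` has derivative
`T g(0) - ∫₀ᵀ g` at `u = 0`. -/
theorem Function.Periodic.hasDerivAt_integral_id_mul {g : ℝ → ℝ} {T : ℝ}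
    (hg : Function.Periodic g T) (hc : Continuous g) :
    HasDerivAt (fun u => ∫ s in (0:ℝ)..T, s * g (u + s)) (T * g 0 - ∫ s in (0:ℝ)..T, g s) 0 := by
  have hi : ∀ {f : ℝ → ℝ}, Continuous f → ∀ a b : ℝ, IntervalIntegrable f MeasureTheory.volume a b :=
    fun hf a b => hf.intervalIntegrable a b
  have hsg : Continuous fun s => s * g s := by fun_prop
  have key : ∀ u, ∫ s in (0:ℝ)..T, s * g (u + s)
      = (∫ s in (0:ℝ)..(u + T), s * g s) - (∫ s in (0:ℝ)..u, s * g s)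
        - u * ∫ s in (0:ℝ)..T, g s := by
    intro u
    have h := intervalIntegral.integral_comp_add_left (a := 0) (b := T)
      (fun s => (s - u) * g s) u
    simp only [add_sub_cancel_left, add_zero] at h
    rw [h, intervalIntegral.integral_interval_sub_left (hi hsg _ _) (hi hsg _ _)]
    simp only [sub_mul]
    rw [intervalIntegral.integral_sub (hi hsg _ _) (hi (by fun_prop) _ _),
      intervalIntegral.integral_const_mul, hg.intervalIntegral_add_eq u 0, zero_add]
  have hd : ∀ u, HasDerivAt (fun u => ∫ s in (0:ℝ)..u, s * g s) (u * g u) u :=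
    fun u => hsg.integral_hasStrictDerivAt 0 u |>.hasDerivAt
  rw [funext key]
  refine ((((hd (0 + T)).comp_add_const 0 T).sub (hd 0)).sub
    ((hasDerivAt_id (0:ℝ)).mul_const (∫ s in (0:ℝ)..T, g s))).congr_deriv ?_
  simp [hg.eq]

theorem exists_beta_homological_equation
    (m : ℕ) (hm : 0 < m) (V : ℝ × ℝ → ℝ)
    (hV : ContDiff ℝ (⊤ : ℕ∞) V)
    (hVper1 : ∀ t x : ℝ, V (t + 2 * π, x) = V (t, x))
    (hVper2 : ∀ t x : ℝ, V (t, x + 2 * π) = V (t, x)) :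
    ∃ β : ℝ × ℝ → ℝ, ContDiff ℝ (⊤ : ℕ∞) β ∧
      (∀ t x : ℝ, β (t + 2 * π, x) = β (t, x)) ∧
      (∀ t x : ℝ, β (t, x + 2 * π) = β (t, x)) ∧
      ∀ t x : ℝ,
        V (t, x) + m * deriv (fun y => β (t, y)) x - deriv (fun s => β (s, x)) t
          = (2 * π)⁻¹ * ∫ s in (0:ℝ)..(2 * π), V (s, (x + m * t) - m * s) := by
  set β : ℝ × ℝ → ℝ := fun p =>
    (2 * π)⁻¹ * ∫ s in (0:ℝ)..(2 * π), s * V (p.1 + s, p.2 - m * s) with hβ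
  have hsmooth : ContDiff ℝ (⊤ : ℕ∞) β := by
    refine contDiff_const.mul (contDiff_infty_intervalIntegral
      (F := fun q : (ℝ × ℝ) × ℝ => q.2 * V (q.1.1 + q.2, q.1.2 - m * q.2)) ?_ _ _)
    fun_prop
  refine ⟨β, hsmooth, fun t x => ?_, fun t x => ?_, fun t x => ?_⟩
  · simp only [hβ, add_right_comm t, hVper1]
  · simp only [hβ, add_sub_right_comm x, hVper2]
  -- `G` is the restriction of `V` to the characteristic through `(0, x + m t)`.
  set G : ℝ → ℝ := fun s => V (s, (x + m * t) - m * s) with hG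
  have hGc : Continuous G := hV.continuous.comp (by fun_prop)
  have hGp : Function.Periodic G (2 * π) := fun s => by
    have hx : Function.Periodic (fun y => V (s, y)) (2 * π) := hVper2 s
    simp only [hG, hVper1]
    convert hx.sub_nat_mul_eq m (x := x + m * t - m * s) using 3
    ring
  have hgp : Function.Periodic (fun s => G (t + s)) (2 * π) := fun s => by
    simp only [← add_assoc, hGp (t + s)]
  have hint : ∫ s in (0:ℝ)..(2 * π), G (t + s) = ∫ s in (0:ℝ)..(2 * π), G s := by
    rw [intervalIntegral.integral_comp_add_left, add_zero,
      hGp.intervalIntegral_add_eq t 0, zero_add]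
  have hline := (hgp.hasDerivAt_integral_id_mul (by fun_prop)).const_mul (2 * π)⁻¹
  have hβd : HasFDerivAt β (fderiv ℝ β (t, x)) (t, x) :=
    (hsmooth.differentiable (by simp) _).hasFDerivAt
  have ht : HasDerivAt (fun s => β (s, x)) (fderiv ℝ β (t, x) (1, 0)) t :=
    hβd.comp_hasDerivAt (f := fun s => (s, x)) t ((hasDerivAt_id t).prodMk (hasDerivAt_const t x))
  have hx : HasDerivAt (fun y => β (t, y)) (fderiv ℝ β (t, x) (0, 1)) x :=
    hβd.comp_hasDerivAt (f := fun y => (t, y)) x ((hasDerivAt_const x t).prodMk (hasDerivAt_id x))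
  have hdir : HasDerivAt (fun u : ℝ => β (t + u, x - m * u)) (fderiv ℝ β (t, x) (1, -m)) 0 := by
    refine HasFDerivAt.comp_hasDerivAt (f := fun u : ℝ => (t + u, x - m * u)) (0 : ℝ)
      (by simpa using hβd) (((hasDerivAt_id (0:ℝ)).const_add t).prodMk ?_)
    simpa using ((hasDerivAt_id (0:ℝ)).const_mul (m : ℝ)).const_sub x
  have hfun : (fun u : ℝ => β (t + u, x - m * u))
      = fun u => (2 * π)⁻¹ * ∫ s in (0:ℝ)..(2 * π), s * G (t + (u + s)) := by
    funext u
    simp only [hβ, hG]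
    congr! 6 with s
    · ring
    · ring
  have heq := (hfun ▸ hdir).unique hline
  have hsplit : fderiv ℝ β (t, x) (1, -m)
      = fderiv ℝ β (t, x) (1, 0) - m * fderiv ℝ β (t, x) (0, 1) := by
    rw [← smul_eq_mul, ← map_smul, ← map_sub]
    simp
  have hG0 : G (t + 0) = V (t, x) := by simp [hG]
  rw [hsplit, hint, hG0, mul_sub, inv_mul_cancel_left₀ two_pi_pos.ne'] at heq
  rw [ht.deriv, hx.deriv]
  linarith
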